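/- Fix integers m, n ≥ 1. (1) The subspace 𝒱^{ı,0}_{m|n,n} is invariant under every left operator B^L_i (i ∈ 𝕀_{2m−1}) and every d^L_r (r ∈ {1/2, 3/2, …, m−1/2}). (2) The ℚ(q)-linear map Λ^ı : V^{⊗n} → 𝒱^{ı,0}_{m|n,n} determined by Λ^ı(v_λ) = t^{(A_λ)} for λ ∈ 𝕀_{2m}^n is a bijection. (3) Λ^ı intertwines the actions: Λ^ı(𝓑_i v) = B^L_i Λ^ı(v) for every i ∈ 𝕀_{2m−1} (including i = 0), and Λ^ı(𝓓_r v) = d^L_r Λ^ı(v) for every r ∈ {1/2, …, m−1/2} and every v ∈ V^{⊗n}. (Thus the ı-weight ρ̄ space of the ıHowe duality module is isomorphic to the ıSchur duality tensor space V^{⊗n} as a module over the ıquantum group.) -/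

import Mathlib

open scoped BigOperators Classical

noncomputable section

/-- The base field `ℚ(q)`. -/
abbrev K : Type := RatFunc ℚ

/-- The indeterminate `q`. -/
def q : K := RatFunc.X

/-- The quantum integer `[r] = (q^r - q^{-r})/(q - q^{-1})`. -/
def qint (r : ℤ) : K := (q ^ r - q ^ (-r)) / (q - q⁻¹)

/-- The quantum factorial `[r]!`. -/
def qfac : ℕ → K
  | 0 => 1
  | n+1 => qfac n * qint (n+1)

/-- The index set `𝕀_N = {-(N-1)/2, -(N-3)/2, …, (N-1)/2}` as a finite set of rationals. -/
def II (N : ℕ) : Finset ℚ := (Finset.range N).image (fun k : ℕ => (k : ℚ) - ((N : ℚ) - 1) / 2)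

theorem II_neg {N : ℕ} {a : ℚ} (h : a ∈ II N) : -a ∈ II N := by
  obtain ⟨k, hk, hv⟩ := Finset.mem_image.mp h
  rw [Finset.mem_range] at hk
  refine Finset.mem_image.mpr ⟨N - 1 - k, Finset.mem_range.mpr (by omega), ?_⟩
  have h1 : ((N - 1 - k : ℕ) : ℚ) = (N : ℚ) - 1 - (k : ℚ) := by
    have h2 : (N : ℚ) = ((N - 1 - k : ℕ) : ℚ) + (k : ℚ) + 1 := by
      exact_mod_cast congrArg (Nat.cast : ℕ → ℚ) (by omega : N = (N - 1 - k) + k + 1)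
    linarith
  rw [h1, ← hv]; ring

/-- Matrices with rational row/column labels and natural number entries. -/
abbrev Mat : Type := ℚ → ℚ → ℕ

/-- The θ-elementary matrix `E^θ_{r,c} = E_{r,c} + E_{-r,-c}`. -/
def chiM (r c : ℚ) : Mat := fun x y =>
  (if x = r ∧ y = c then 1 else 0) + (if x = -r ∧ y = -c then 1 else 0)

/-- `A + E^θ_{p,j} - E^θ_{p',j'}` (truncated ℕ-subtraction; only used where the
corresponding q-integer coefficient vanishes otherwise). -/
def matMove (A : Mat) (p j p' j' : ℚ) : Mat := fun x y => A x y + chiM p j x y - chiM p' j' x y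

/-- Free `ℚ(q)`-vector space on the set of matrices `P`. -/
abbrev FM (P : Set Mat) : Type := {A : Mat // A ∈ P} →₀ K

/-- Basis vector `t^{(A)}` (zero if `A ∉ P`). -/
def tP (P : Set Mat) (A : Mat) : FM P := if h : A ∈ P then Finsupp.single ⟨A, h⟩ 1 else 0

/-- Linear operator on `FM P` defined by its values on basis vectors. -/
def opOf {P : Set Mat} (f : Mat → FM P) : FM P →ₗ[K] FM P :=
  Finsupp.lift (FM P) K {A : Mat // A ∈ P} fun A => f A.1

/-- The set `Ξ^ı_{m|n,d}`: matrices supported on `𝕀_{2m} × 𝕀_{2n}`, centro-symmetric,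
with total entry sum `2d`. -/
def Xiι (m n d : ℕ) : Set Mat :=
  {A | (∀ i j, A i j ≠ 0 → i ∈ II (2*m) ∧ j ∈ II (2*n)) ∧
       (∀ i j, A i j = A (-i) (-j)) ∧
       ∑ i ∈ II (2*m), ∑ j ∈ II (2*n), A i j = 2*d}

/-- Left operator `B^L_i` (ı-case), for `i ∈ 𝕀_{2m-1}`, `i ≠ 0`. -/
def BLι (n : ℕ) (P : Set Mat) (i : ℚ) : FM P →ₗ[K] FM P :=
  opOf fun A => ∑ j ∈ II (2*n),
    (q ^ ((∑ k ∈ (II (2*n)).filter (fun k => j ≤ k), ((A (i+1/2) k : ℤ) - (A (i-1/2) k : ℤ))) + 1)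
      * qint (A (i-1/2) j)) • tP P (matMove A (i+1/2) j (i-1/2) j)

/-- Left operator `B^L_0` (ı-case). -/
def BL0ι (n : ℕ) (P : Set Mat) : FM P →ₗ[K] FM P :=
  opOf fun A =>
    (∑ j ∈ II (2*n),
      (q ^ ((∑ k ∈ (II (2*n)).filter (fun k => j ≤ k), ((A (1/2) k : ℤ) - (A (-(1/2)) k : ℤ)))
            + (if 0 < j then 1 else 0))
        * qint (A (-(1/2)) j)) • tP P (matMove A (1/2) j (-(1/2)) j))
    + (q ^ (∑ j ∈ (II (2*n)).filter (fun j => 0 < j), ((A (1/2) j : ℤ) - (A (-(1/2)) j : ℤ)))) • tP P A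

/-- Left Cartan operator `(d^L_r)^e` for `e = ±1` (ı-case). -/
def dLι (n : ℕ) (P : Set Mat) (r : ℚ) (e : ℤ) : FM P →ₗ[K] FM P :=
  opOf fun A => (q ^ (e * ∑ j ∈ II (2*n), (A r j : ℤ))) • tP P A

/-- Right operator `B^R_i` (ı-case), for `i ∈ 𝕀_{2n-1}`, `i ≠ 0`. -/
def BRι (m : ℕ) (P : Set Mat) (i : ℚ) : FM P →ₗ[K] FM P :=
  opOf fun A => ∑ j ∈ II (2*m),
    (q ^ (∑ k ∈ (II (2*m)).filter (fun k => j < k), ((A k (i+1/2) : ℤ) - (A k (i-1/2) : ℤ)))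
      * qint (A j (i+1/2))) • tP P (matMove A j (i-1/2) j (i+1/2))

/-- Right operator `B^R_0` (ı-case). -/
def BR0ι (m : ℕ) (P : Set Mat) : FM P →ₗ[K] FM P :=
  opOf fun A =>
    (∑ j ∈ II (2*m),
      (q ^ ((∑ k ∈ (II (2*m)).filter (fun k => j < k), ((A k (1/2) : ℤ) - (A k (-(1/2)) : ℤ)))
            + (if j < 0 then 1 else 0))
        * qint (A j (1/2))) • tP P (matMove A j (-(1/2)) j (1/2)))
    + (q ^ (∑ j ∈ (II (2*m)).filter (fun j => 0 < j), ((A j (1/2) : ℤ) - (A j (-(1/2)) : ℤ)))) • tP P A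

/-- Right Cartan operator `(d^R_r)^e` for `e = ±1` (ı-case). -/
def dRι (m : ℕ) (P : Set Mat) (r : ℚ) (e : ℤ) : FM P →ₗ[K] FM P :=
  opOf fun A => (q ^ (e * ∑ k ∈ II (2*m), (A k r : ℤ))) • tP P A

/-- The subset `Ξ^{ı,0}_{m|n,n}` (all column sums equal to `1`). -/
def Xi0ι (m n : ℕ) : Set Mat :=
  {A | A ∈ Xiι m n n ∧ ∀ j ∈ II (2*n), ∑ i ∈ II (2*m), A i j = 1}

/-- The ı-weight `ρ̄` subspace `𝒱^{ı,0}_{m|n,n}`. -/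
def V0ι (m n : ℕ) : Submodule K (FM (Xiι m n n)) :=
  Submodule.span K {v | ∃ A ∈ Xi0ι m n, v = tP (Xiι m n n) A}

/-- Basis index of `V`: elements of `𝕀_M`. -/
def SubI (M : ℕ) : Type := {a : ℚ // a ∈ II M}

/-- `V^{⊗n}`: free `ℚ(q)`-vector space on `n`-tuples from `𝕀_M`. -/
abbrev TV (n M : ℕ) : Type := (Fin n → SubI M) →₀ K

/-- Basis vector `v_λ`. -/
def tT {n M : ℕ} (l : Fin n → SubI M) : TV n M := Finsupp.single l 1

/-- A "single-target" operator on `V`: `v_a ↦ c a • v_{t a}`. -/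
structure SOp where
  t : ℚ → ℚ
  c : ℚ → K

def SOp.id' : SOp := ⟨fun a => a, fun _ => 1⟩
/-- Composite `O ∘ P`. -/
def SOp.comp (O P : SOp) : SOp := ⟨fun a => O.t (P.t a), fun a => P.c a * O.c (P.t a)⟩
/-- `E_i v_a = δ(a = i+1/2) v_{a-1}`. -/
def Eop (i : ℚ) : SOp := ⟨fun a => a - 1, fun a => if a = i + 1/2 then 1 else 0⟩
/-- `F_i v_a = δ(a = i-1/2) v_{a+1}`. -/
def Fop (i : ℚ) : SOp := ⟨fun a => a + 1, fun a => if a = i - 1/2 then 1 else 0⟩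
/-- A diagonal operator `v_a ↦ q^{f a} v_a`. -/
def diagOp (f : ℚ → ℤ) : SOp := ⟨fun a => a, fun a => q ^ f a⟩
/-- `K_i^{-1}` (diagonal). -/
def Kinv (i : ℚ) : SOp := diagOp fun a => (if a = i+1/2 then 1 else 0) - (if a = i-1/2 then 1 else 0)
/-- `K_i` (diagonal). -/
def Kpos (i : ℚ) : SOp := diagOp fun a => (if a = i-1/2 then 1 else 0) - (if a = i+1/2 then 1 else 0)
/-- `k_i^{-1} = K_i^{-1} K_{-i}`. -/
def kinv (i : ℚ) : SOp := (Kinv i).comp (Kpos (-i))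
/-- `k_i = K_i K_{-i}^{-1}`. -/
def kpos (i : ℚ) : SOp := (Kpos i).comp (Kinv (-i))
/-- `(D_r D_{-r})^e` (diagonal), `e = ±1`. -/
def DDop (r : ℚ) (e : ℤ) : SOp := diagOp fun a => e * ((if a = r then 1 else 0) + (if a = -r then 1 else 0))
/-- `D_0^e` (diagonal), `e = ±1`. -/
def D0op (e : ℤ) : SOp := diagOp fun a => e * (if a = 0 then 1 else 0)

/-- Tensor product `ops 0 ⊗ ops 1 ⊗ ⋯ ⊗ ops (n-1)` of single-target operators on `V^{⊗n}`. -/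
def tensorOp {n M : ℕ} (ops : Fin n → SOp) : TV n M →ₗ[K] TV n M :=
  Finsupp.lift (TV n M) K (Fin n → SubI M) fun l =>
    if h : ∀ r, (ops r).t (l r).1 ∈ II M then
      Finsupp.single (fun r => ⟨(ops r).t (l r).1, h r⟩) (∏ r, (ops r).c (l r).1)
    else 0

/-- `𝓑_i` on `V^{⊗n}`, for `i ≠ 0` (ı-case) resp. `i ∈ {1/2,…,m-1/2}` (ȷ-case). -/
def calB (n M : ℕ) (i : ℚ) : TV n M →ₗ[K] TV n M :=
  (∑ r : Fin n, tensorOp fun s => if s < r then SOp.id' else if s = r then Fop i else Kinv i)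
  + (∑ r : Fin n, tensorOp fun s => if s < r then kinv i else if s = r then (Eop (-i)).comp (Kinv i) else Kinv i)

/-- `𝓑_0` on `V^{⊗n}` (ı-case). -/
def calB0 (n M : ℕ) : TV n M →ₗ[K] TV n M :=
  (∑ r : Fin n, tensorOp fun s => if s < r then SOp.id' else if s = r then Fop 0 else Kinv 0)
  + q⁻¹ • (∑ r : Fin n, tensorOp fun s => if s < r then SOp.id' else if s = r then (Eop 0).comp (Kinv 0) else Kinv 0)
  + tensorOp fun _ => Kinv 0

/-- `𝓑_{-i}` on `V^{⊗n}` (ȷ-case), for `i ∈ {1/2,…,m-1/2}`. -/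
def calBn (n M : ℕ) (i : ℚ) : TV n M →ₗ[K] TV n M :=
  (∑ r : Fin n, tensorOp fun s => if s < r then SOp.id' else if s = r then Fop (-i) else Kinv (-i))
  + (∑ r : Fin n, tensorOp fun s => if s < r then kpos i else if s = r then (Kinv (-i)).comp (Eop i) else Kinv (-i))

/-- `𝓓_r^e = ((D_r D_{-r})^e)^{⊗n}`. -/
def calD (n M : ℕ) (r : ℚ) (e : ℤ) : TV n M →ₗ[K] TV n M := tensorOp fun _ => DDop r e

/-- `𝓓_0^e = (D_0^e)^{⊗n}`. -/
def calD0 (n M : ℕ) (e : ℤ) : TV n M →ₗ[K] TV n M := tensorOp fun _ => D0op e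

/-- Negation on `𝕀_M`. -/
def negS {M : ℕ} (a : SubI M) : SubI M := ⟨-a.1, II_neg a.2⟩

/-- `λ · s` where `s` interchanges the tensor positions `a` and `b`. -/
def swapL {n M : ℕ} (a b : Fin n) (l : Fin n → SubI M) : Fin n → SubI M := l ∘ Equiv.swap a b

/-- The Hecke operator `σ` acting in tensor positions `a, b` (for `a < b` adjacent). -/
def sigmaI {n M : ℕ} (a b : Fin n) : TV n M →ₗ[K] TV n M :=
  Finsupp.lift (TV n M) K (Fin n → SubI M) fun l =>
    if (l a).1 < (l b).1 then tT (swapL a b l)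
    else if (l a).1 = (l b).1 then q⁻¹ • tT l
    else tT (swapL a b l) + (q⁻¹ - q) • tT l

/-- The Hecke operator `σ_0`. -/
def sigma0 {n M : ℕ} (hn : 0 < n) : TV n M →ₗ[K] TV n M :=
  Finsupp.lift (TV n M) K (Fin n → SubI M) fun l =>
    if 0 < (l ⟨0, hn⟩).1 then tT (Function.update l ⟨0, hn⟩ (negS (l ⟨0, hn⟩)))
    else if (l ⟨0, hn⟩).1 = 0 then q⁻¹ • tT l
    else tT (Function.update l ⟨0, hn⟩ (negS (l ⟨0, hn⟩))) + (q⁻¹ - q) • tT l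

/-- `σ_i`, `0 ≤ i ≤ n-1` (for `i ≥ 1` it acts on the 1-based entries `λ_i, λ_{i+1}`). -/
def sigmaB {n M : ℕ} (hn : 0 < n) (i : ℕ) (hi : i < n) : TV n M →ₗ[K] TV n M :=
  if i = 0 then sigma0 hn else sigmaI ⟨i - 1, by omega⟩ ⟨i, hi⟩

/-- The 0-1 matrix `A_λ` (ı-case): column `j - 1/2` is `e_{λ_j}` and column `-(j - 1/2)`
is `e_{-λ_j}`, for `j = 1, …, n` (here `j : Fin n` is 0-based, so column `j + 1/2`). -/
def Aι {n : ℕ} (l : Fin n → ℚ) : Mat := fun x y =>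
  ∑ j : Fin n, ((if y = (j : ℚ) + 1/2 ∧ x = l j then 1 else 0)
              + (if y = -((j : ℚ) + 1/2) ∧ x = -(l j) then 1 else 0))

/-- The linear map `Λ^ı : V^{⊗n} → 𝒱^ı_{m|n,n}`, `v_λ ↦ t^{(A_λ)}`. -/
def Lamι (m n : ℕ) : TV n (2*m) →ₗ[K] FM (Xiι m n n) :=
  Finsupp.lift (FM (Xiι m n n)) K (Fin n → SubI (2*m)) fun l =>
    tP (Xiι m n n) (Aι fun r => (l r).1)

theorem q_ne_zero : q ≠ 0 := RatFunc.X_ne_zero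

theorem q_sub_inv_ne_zero : q - q⁻¹ ≠ 0 := by
  intro h
  have h1 : q * q = 1 := by
    rw [sub_eq_zero] at h
    nth_rewrite 2 [h]
    exact mul_inv_cancel₀ q_ne_zero
  have h2 : (Polynomial.X * Polynomial.X : Polynomial ℚ) = 1 := by
    apply RatFunc.algebraMap_injective ℚ
    rw [map_mul, map_one, RatFunc.algebraMap_X]
    exact h1
  simpa using congrArg (Polynomial.eval 0) h2

theorem qint_zero : qint 0 = 0 := by simp [qint]

theorem qint_one : qint 1 = 1 := by
  simp [qint, div_self q_sub_inv_ne_zero]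

theorem prod_q_zpow {ι : Type*} (s : Finset ι) (g : ι → ℤ) :
    ∏ x ∈ s, q ^ g x = q ^ ∑ x ∈ s, g x := by
  induction s using Finset.induction_on with
  | empty => simp
  | insert a s ha ih => rw [Finset.prod_insert ha, Finset.sum_insert ha, ih, zpow_add₀ q_ne_zero]

section HalfIntegers

variable {n : ℕ}

theorem half_ne_neg_half (r s : Fin n) : (r : ℚ) + 1/2 ≠ -((s : ℚ) + 1/2) := by
  have h1 : (0 : ℚ) ≤ (r : ℕ) := Nat.cast_nonneg _
  have h2 : (0 : ℚ) ≤ (s : ℕ) := Nat.cast_nonneg _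
  intro h
  linarith

theorem half_le_half (r s : Fin n) : (r : ℚ) + 1/2 ≤ (s : ℚ) + 1/2 ↔ r ≤ s := by
  rw [add_le_add_iff_right, Nat.cast_le, Fin.val_fin_le]

theorem half_inj (r s : Fin n) : (r : ℚ) + 1/2 = (s : ℚ) + 1/2 ↔ r = s := by
  rw [add_left_inj, Nat.cast_inj, Fin.val_inj]

theorem half_pos' (r : Fin n) : 0 < (r : ℚ) + 1/2 := by positivity

theorem neg_half_le_half (r s : Fin n) : -((r : ℚ) + 1/2) ≤ (s : ℚ) + 1/2 := by
  linarith [half_pos' r, half_pos' s]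

theorem not_half_le_neg_half (r s : Fin n) : ¬ (r : ℚ) + 1/2 ≤ -((s : ℚ) + 1/2) := by
  linarith [half_pos' r, half_pos' s]

theorem mem_II_two_mul {y : ℚ} :
    y ∈ II (2*n) ↔ ∃ r : Fin n, y = (r : ℚ) + 1/2 ∨ y = -((r : ℚ) + 1/2) := by
  simp only [II, Finset.mem_image, Finset.mem_range]
  constructor
  · rintro ⟨k, hk, rfl⟩
    rcases lt_or_ge k n with h | h
    · refine ⟨⟨n - 1 - k, by omega⟩, Or.inr ?_⟩
      have h2 : (n : ℚ) = ((n - 1 - k : ℕ) : ℚ) + (k : ℚ) + 1 := by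
        exact_mod_cast (by omega : n = (n - 1 - k) + k + 1)
      push_cast
      linarith
    · refine ⟨⟨k - n, by omega⟩, Or.inl ?_⟩
      push_cast [Nat.cast_sub h]
      ring
  · rintro ⟨r, rfl | rfl⟩
    · refine ⟨n + r, by omega, ?_⟩
      push_cast
      ring
    · refine ⟨n - 1 - r, by omega, ?_⟩
      have h2 : (n : ℚ) = ((n - 1 - r : ℕ) : ℚ) + (r : ℚ) + 1 := by
        exact_mod_cast (by omega : n = (n - 1 - r) + r + 1)
      push_cast
      linarith

theorem sum_II_two_mul {M : Type*} [AddCommMonoid M] (f : ℚ → M) :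
    ∑ y ∈ II (2*n), f y = ∑ r : Fin n, (f ((r : ℚ) + 1/2) + f (-((r : ℚ) + 1/2))) := by
  have h : II (2*n) = Finset.univ.image (fun r : Fin n => (r : ℚ) + 1/2)
      ∪ Finset.univ.image (fun r : Fin n => -((r : ℚ) + 1/2)) := by
    ext y
    rw [mem_II_two_mul]
    simp only [Finset.mem_union, Finset.mem_image, Finset.mem_univ, true_and, exists_or, eq_comm]
  rw [h, Finset.sum_union, Finset.sum_image, Finset.sum_image, Finset.sum_add_distrib]
  · intro r _ s _ hrs
    exact (half_inj r s).1 (neg_injective hrs)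
  · intro r _ s _ hrs
    exact (half_inj r s).1 hrs
  · rw [Finset.disjoint_left]
    intro y hy hy'
    obtain ⟨r, -, rfl⟩ := Finset.mem_image.1 hy
    obtain ⟨s, -, hs⟩ := Finset.mem_image.1 hy'
    exact half_ne_neg_half r s hs.symm

end HalfIntegers

section WeightMatrices

variable {n : ℕ}

theorem Aι_half (l : Fin n → ℚ) (x : ℚ) (r : Fin n) :
    Aι l x ((r : ℚ) + 1/2) = if x = l r then 1 else 0 := by
  simp only [Aι, half_inj, half_ne_neg_half, false_and, if_false, add_zero, ite_and]
  rw [Finset.sum_ite_eq, if_pos (Finset.mem_univ r)]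

theorem Aι_neg_half (l : Fin n → ℚ) (x : ℚ) (r : Fin n) :
    Aι l x (-((r : ℚ) + 1/2)) = if x = -(l r) then 1 else 0 := by
  simp only [Aι, neg_inj, half_inj, (half_ne_neg_half _ _).symm, false_and, if_false, zero_add,
    ite_and]
  rw [Finset.sum_ite_eq, if_pos (Finset.mem_univ r)]

theorem Aι_of_notMem (l : Fin n → ℚ) (x : ℚ) {y : ℚ} (hy : y ∉ II (2*n)) : Aι l x y = 0 := by
  rw [mem_II_two_mul] at hy
  push Not at hy
  refine Finset.sum_eq_zero fun r _ => ?_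
  rw [if_neg fun h => (hy r).1 h.1, if_neg fun h => (hy r).2 h.1, add_zero]

theorem Aι_neg_neg (l : Fin n → ℚ) (x y : ℚ) : Aι l (-x) (-y) = Aι l x y := by
  refine Finset.sum_congr rfl fun r _ => ?_
  rw [add_comm]
  simp only [neg_eq_iff_eq_neg, neg_neg]

theorem Aι_injective : Function.Injective (Aι : (Fin n → ℚ) → Mat) := by
  intro l l' h
  funext r
  have h1 := congrFun (congrFun h (l r)) ((r : ℚ) + 1/2)
  rw [Aι_half, Aι_half, if_pos rfl] at h1
  by_contra hne
  rw [if_neg hne] at h1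
  exact one_ne_zero h1

theorem Aι_mem_Xi0ι_iff {m : ℕ} (l : Fin n → ℚ) :
    Aι l ∈ Xi0ι m n ↔ ∀ r, l r ∈ II (2*m) := by
  constructor
  · intro h r
    refine (h.1.1 (l r) ((r : ℚ) + 1/2) ?_).1
    rw [Aι_half, if_pos rfl]
    exact one_ne_zero
  · intro h
    have hcol : ∀ y ∈ II (2*n), ∑ x ∈ II (2*m), Aι l x y = 1 := by
      intro y hy
      obtain ⟨r, rfl | rfl⟩ := mem_II_two_mul.1 hy
      · simp only [Aι_half, Finset.sum_ite_eq', h r, if_true]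
      · simp only [Aι_neg_half, Finset.sum_ite_eq', II_neg (h r), if_true]
    refine ⟨⟨?_, fun i j => (Aι_neg_neg l i j).symm, ?_⟩, hcol⟩
    · intro x y hxy
      have hy : y ∈ II (2*n) := by
        by_contra hy
        exact hxy (Aι_of_notMem l x hy)
      refine ⟨?_, hy⟩
      obtain ⟨r, rfl | rfl⟩ := mem_II_two_mul.1 hy
      · rw [Aι_half] at hxy
        by_cases hx : x = l r
        · exact hx ▸ h r
        · exact absurd (if_neg hx) hxy
      · rw [Aι_neg_half] at hxy
        by_cases hx : x = -(l r)
        · exact hx ▸ II_neg (h r)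
        · exact absurd (if_neg hx) hxy
    · rw [Finset.sum_comm, Finset.sum_congr rfl hcol, sum_II_two_mul]
      simp [mul_comm]

theorem Aι_mem_Xiι_iff {m : ℕ} (l : Fin n → ℚ) :
    Aι l ∈ Xiι m n n ↔ ∀ r, l r ∈ II (2*m) := by
  refine ⟨fun h r => (h.1 (l r) ((r : ℚ) + 1/2) ?_).1, fun h => ((Aι_mem_Xi0ι_iff l).2 h).1⟩
  rw [Aι_half, if_pos rfl]
  exact one_ne_zero

theorem exists_eq_Aι {m : ℕ} {A : Mat} (hA : A ∈ Xi0ι m n) :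
    ∃ l : Fin n → ℚ, A = Aι l := by
  have hcol : ∀ r : Fin n, ∃ i ∈ II (2*m), ∀ x, A x ((r : ℚ) + 1/2) = if x = i then 1 else 0 := by
    intro r
    have hsum := hA.2 _ (mem_II_two_mul.2 ⟨r, Or.inl rfl⟩)
    obtain ⟨i, hi, hne⟩ := Finset.exists_ne_zero_of_sum_ne_zero (hsum.trans_ne one_ne_zero)
    refine ⟨i, hi, fun x => ?_⟩
    rw [← Finset.add_sum_erase _ _ hi] at hsum
    by_cases hx : x = i
    · rw [if_pos hx, hx]
      omega
    · rw [if_neg hx]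
      by_cases hxI : x ∈ II (2*m)
      · have h0 : ∑ x ∈ (II (2*m)).erase i, A x ((r : ℚ) + 1/2) = 0 := by omega
        exact Finset.sum_eq_zero_iff.1 h0 x (Finset.mem_erase.2 ⟨hx, hxI⟩)
      · by_contra h
        exact hxI (hA.1.1 _ _ h).1
  choose l _ hl using hcol
  refine ⟨l, ?_⟩
  funext x y
  by_cases hy : y ∈ II (2*n)
  · obtain ⟨r, rfl | rfl⟩ := mem_II_two_mul.1 hy
    · rw [hl, Aι_half]
    · rw [hA.1.2.1, neg_neg, hl, Aι_neg_half]
      simp only [neg_eq_iff_eq_neg]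
  · rw [Aι_of_notMem l x hy]
    by_contra h
    exact hy (hA.1.1 _ _ h).2

theorem matMove_Aι_half (l : Fin n → ℚ) (r : Fin n) (p : ℚ) :
    matMove (Aι l) p ((r : ℚ) + 1/2) (l r) ((r : ℚ) + 1/2) = Aι (Function.update l r p) := by
  funext x y
  simp only [matMove, chiM]
  by_cases hy : y ∈ II (2*n)
  · obtain ⟨s, rfl | rfl⟩ := mem_II_two_mul.1 hy
    · rw [Aι_half, Aι_half]
      simp only [half_inj, half_ne_neg_half, and_false, if_false, add_zero]
      by_cases hs : s = r
      · subst hs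
        simp
      · simp [hs]
    · rw [Aι_neg_half, Aι_neg_half]
      simp only [neg_inj, half_inj, (half_ne_neg_half _ _).symm, and_false, if_false, zero_add]
      by_cases hs : s = r
      · subst hs
        simp
      · simp [hs]
  · have h1 : y ≠ (r : ℚ) + 1/2 := fun h => hy (mem_II_two_mul.2 ⟨r, Or.inl h⟩)
    have h2 : y ≠ -((r : ℚ) + 1/2) := fun h => hy (mem_II_two_mul.2 ⟨r, Or.inr h⟩)
    simp only [Aι_of_notMem _ _ hy, h1, h2, and_false, if_false, add_zero, tsub_zero]

theorem chiM_neg_neg (r c : ℚ) : chiM (-r) (-c) = chiM r c := by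
  funext x y
  simp only [chiM, neg_neg, add_comm]

theorem matMove_Aι_neg_half (l : Fin n → ℚ) (r : Fin n) (p : ℚ) :
    matMove (Aι l) p (-((r : ℚ) + 1/2)) (-l r) (-((r : ℚ) + 1/2))
      = Aι (Function.update l r (-p)) := by
  rw [← matMove_Aι_half]
  unfold matMove
  rw [chiM_neg_neg, ← chiM_neg_neg p, neg_neg]

end WeightMatrices

section Operators

variable {m n : ℕ}

theorem tP_of_notMem {P : Set Mat} {A : Mat} (h : A ∉ P) : tP P A = 0 := dif_neg h

theorem opOf_tP {P : Set Mat} (f : Mat → FM P) {A : Mat} (h : A ∈ P) : opOf f (tP P A) = f A := by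
  simp [opOf, tP, h]

theorem Lamι_single (l : Fin n → SubI (2*m)) (c : K) :
    Lamι m n (Finsupp.single l c) = c • tP (Xiι m n n) (Aι fun r => (l r).1) := by
  simp [Lamι]

theorem Aι_coe_mem_Xi0ι (l : Fin n → SubI (2*m)) : Aι (fun r => (l r).1) ∈ Xi0ι m n :=
  (Aι_mem_Xi0ι_iff _).2 fun r => (l r).2

theorem Lamι_tensorOp (ops : Fin n → SOp) (l : Fin n → SubI (2*m)) :
    Lamι m n (tensorOp ops (tT l))
      = (∏ r, (ops r).c (l r).1) • tP (Xiι m n n) (Aι fun r => (ops r).t (l r).1) := by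
  simp only [tensorOp, tT, Finsupp.lift_apply, Finsupp.sum_single_index, zero_smul, one_smul]
  split_ifs with h
  · exact Lamι_single _ _
  · rw [map_zero, tP_of_notMem, smul_zero]
    rwa [Aι_mem_Xiι_iff]

theorem Lamι_tensorOp_eq_zero {ops : Fin n → SOp} {l : Fin n → SubI (2*m)} (r : Fin n)
    (h : (ops r).c (l r).1 = 0) : Lamι m n (tensorOp ops (tT l)) = 0 := by
  rw [Lamι_tensorOp, Finset.prod_eq_zero (Finset.mem_univ r) h, zero_smul]

theorem Lamι_tensorOp_update {ops : Fin n → SOp} {l : Fin n → SubI (2*m)} (r : Fin n) (b : ℚ)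
    (g : Fin n → ℤ) (hr : (ops r).t (l r).1 = b) (ht : ∀ s, s ≠ r → (ops s).t (l s).1 = (l s).1)
    (hc : ∀ s, (ops s).c (l s).1 = q ^ g s) :
    Lamι m n (tensorOp ops (tT l))
      = q ^ (∑ s, g s) • tP (Xiι m n n) (Aι (Function.update (fun s => (l s).1) r b)) := by
  rw [Lamι_tensorOp, Finset.prod_congr rfl fun s _ => hc s, prod_q_zpow]
  congr 3
  funext s
  by_cases hs : s = r
  · subst hs
    rw [hr, Function.update_self]
  · rw [ht s hs, Function.update_of_ne hs]

theorem sum_II_filter_half_le (l : Fin n → ℚ) (r : Fin n) (x x' : ℚ) :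
    ∑ k ∈ (II (2*n)).filter (fun k => (r : ℚ) + 1/2 ≤ k), ((Aι l x k : ℤ) - (Aι l x' k : ℤ))
      = ∑ s, if r ≤ s then (if l s = x then 1 else 0) - (if l s = x' then 1 else 0) else 0 := by
  rw [Finset.sum_filter, sum_II_two_mul]
  refine Finset.sum_congr rfl fun s _ => ?_
  simp only [half_le_half, not_half_le_neg_half, if_false, add_zero, Aι_half, Nat.cast_ite,
    Nat.cast_one, Nat.cast_zero, eq_comm]

theorem sum_II_filter_neg_half_le (l : Fin n → ℚ) (r : Fin n) (x x' : ℚ) :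
    ∑ k ∈ (II (2*n)).filter (fun k => -((r : ℚ) + 1/2) ≤ k), ((Aι l x k : ℤ) - (Aι l x' k : ℤ))
      = ∑ s, ((if l s = x then 1 else 0) - (if l s = x' then 1 else 0)
          + if s ≤ r then (if l s = -x then 1 else 0) - (if l s = -x' then 1 else 0) else 0) := by
  rw [Finset.sum_filter, sum_II_two_mul]
  refine Finset.sum_congr rfl fun s _ => ?_
  simp only [neg_half_le_half, neg_le_neg_iff, half_le_half, if_true, Aι_half, Aι_neg_half,
    Nat.cast_ite, Nat.cast_one, Nat.cast_zero, @eq_comm ℚ x, @eq_comm ℚ x', neg_eq_iff_eq_neg]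

theorem sum_II_filter_pos (l : Fin n → ℚ) (x x' : ℚ) :
    ∑ k ∈ (II (2*n)).filter (fun k => 0 < k), ((Aι l x k : ℤ) - (Aι l x' k : ℤ))
      = ∑ s, ((if l s = x then 1 else 0) - (if l s = x' then 1 else 0)) := by
  rw [Finset.sum_filter, sum_II_two_mul]
  refine Finset.sum_congr rfl fun s _ => ?_
  have h : ¬ 0 < -((s : ℚ) + 1/2) := by linarith [half_pos' s]
  simp only [half_pos', h, if_true, if_false, add_zero, Aι_half, Nat.cast_ite, Nat.cast_one,
    Nat.cast_zero, eq_comm]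

theorem sum_add_one_eq (f g : Fin n → ℤ) (r : Fin n) (h : ∀ s, s ≠ r → f s = g s)
    (hr : f r + 1 = g r) : ∑ s, f s + 1 = ∑ s, g s := by
  rw [← Finset.add_sum_erase _ f (Finset.mem_univ r), ← Finset.add_sum_erase _ g (Finset.mem_univ r),
    Finset.sum_congr rfl fun s hs => h s (Finset.ne_of_mem_erase hs), ← hr]
  ring

theorem sum_II_filter_half_le_add_one {l : Fin n → ℚ} {r : Fin n} {x x' : ℚ} (hx : x' ≠ x)
    (hr : l r = x') :
    ∑ k ∈ (II (2*n)).filter (fun k => (r : ℚ) + 1/2 ≤ k), ((Aι l x k : ℤ) - (Aι l x' k : ℤ)) + 1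
      = ∑ s, if r < s then (if l s = x then 1 else 0) - (if l s = x' then 1 else 0) else 0 := by
  rw [sum_II_filter_half_le]
  apply sum_add_one_eq _ _ r
  · intro s hs
    simp only [lt_iff_le_and_ne, hs.symm, ne_eq, not_false_eq_true, and_true]
  · simp [hr, hx]

theorem sum_II_filter_neg_half_le_add_one {l : Fin n → ℚ} {r : Fin n} {x x' : ℚ} (hx : x' ≠ x)
    (hr : l r = -x') :
    ∑ k ∈ (II (2*n)).filter (fun k => -((r : ℚ) + 1/2) ≤ k),
        ((Aι l x k : ℤ) - (Aι l x' k : ℤ)) + 1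
      = ∑ s, ((if l s = x then 1 else 0) - (if l s = x' then 1 else 0)
          + if s < r then (if l s = -x then 1 else 0) - (if l s = -x' then 1 else 0) else 0) := by
  rw [sum_II_filter_neg_half_le]
  apply sum_add_one_eq _ _ r
  · intro s hs
    simp only [lt_iff_le_and_ne, hs, ne_eq, not_false_eq_true, and_true]
  · simp [hr, hx]

theorem sum_II_filter_neg_half_le_self {l : Fin n → ℚ} {r : Fin n} {x : ℚ} (hx : x ≠ 0)
    (hr : l r = x) :
    ∑ k ∈ (II (2*n)).filter (fun k => -((r : ℚ) + 1/2) ≤ k),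
        ((Aι l x k : ℤ) - (Aι l (-x) k : ℤ)) + 1
      = ∑ s, if s < r then 0 else (if l s = x then 1 else 0) - (if l s = -x then 1 else 0) := by
  rw [sum_II_filter_neg_half_le]
  apply sum_add_one_eq _ _ r
  · intro s hs
    simp only [neg_neg]
    rcases lt_or_gt_of_ne hs with h | h
    · rw [if_pos h.le, if_pos h]
      ring
    · rw [if_neg h.not_ge, if_neg h.not_gt, add_zero]
  · simp [hr, self_eq_neg, hx]

theorem qint_Aι_half_smul (l : Fin n → ℚ) (r : Fin n) (p p' : ℚ) (c : K) (P : Set Mat) :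
    (c * qint (Aι l p' ((r : ℚ) + 1/2)))
        • tP P (matMove (Aι l) p ((r : ℚ) + 1/2) p' ((r : ℚ) + 1/2))
      = if l r = p' then c • tP P (Aι (Function.update l r p)) else 0 := by
  rw [Aι_half]
  split_ifs with h1 h2 h2
  · rw [h1, matMove_Aι_half, Nat.cast_one, qint_one, mul_one]
  · exact absurd h1.symm h2
  · exact absurd h2.symm h1
  · rw [Nat.cast_zero, qint_zero, mul_zero, zero_smul]

theorem qint_Aι_neg_half_smul (l : Fin n → ℚ) (r : Fin n) (p p' : ℚ) (c : K) (P : Set Mat) :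
    (c * qint (Aι l p' (-((r : ℚ) + 1/2))))
        • tP P (matMove (Aι l) p (-((r : ℚ) + 1/2)) p' (-((r : ℚ) + 1/2)))
      = if l r = -p' then c • tP P (Aι (Function.update l r (-p))) else 0 := by
  rw [Aι_neg_half]
  split_ifs with h1 h2 h2
  · rw [h1, matMove_Aι_neg_half, Nat.cast_one, qint_one, mul_one]
  · exact absurd (by rw [h1, neg_neg]) h2
  · exact absurd (by rw [h2, neg_neg]) h1
  · rw [Nat.cast_zero, qint_zero, mul_zero, zero_smul]

theorem Lamι_tensorOp_Fop {i p p' : ℚ} (hp : p = i + 1/2) (hp' : p' = i - 1/2)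
    (l : Fin n → SubI (2*m)) (r : Fin n) :
    Lamι m n (tensorOp (fun s => if s < r then SOp.id' else if s = r then Fop i else Kinv i) (tT l))
      = (q ^ (∑ k ∈ (II (2*n)).filter (fun k => (r : ℚ) + 1/2 ≤ k),
            ((Aι (fun s => (l s).1) p k : ℤ) - (Aι (fun s => (l s).1) p' k : ℤ)) + 1)
          * qint (Aι (fun s => (l s).1) p' ((r : ℚ) + 1/2)))
        • tP (Xiι m n n)
          (matMove (Aι fun s => (l s).1) p ((r : ℚ) + 1/2) p' ((r : ℚ) + 1/2)) := by
  have hpp : p' ≠ p := by rw [hp, hp']; linarith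
  rw [qint_Aι_half_smul]
  split_ifs with h
  · rw [sum_II_filter_half_le_add_one hpp h]
    refine Lamι_tensorOp_update r p _ ?_ ?_ ?_
    · simp only [lt_irrefl, if_false, if_true, Fop]
      rw [h, hp, hp']
      ring
    · intro s hs
      simp only [hs, if_false]
      split_ifs <;> rfl
    · intro s
      rcases lt_trichotomy s r with hs | rfl | hs
      · simp [hs, hs.not_gt, SOp.id']
      · simp [Fop, h, hp']
      · simp [hs, hs.not_gt, hs.ne', Kinv, diagOp, hp, hp']
  · rw [hp'] at h
    refine Lamι_tensorOp_eq_zero r ?_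
    simp only [lt_irrefl, if_false, if_true, Fop]
    exact if_neg h

theorem Lamι_tensorOp_Eop_neg {i p p' : ℚ} (hp : p = i + 1/2) (hp' : p' = i - 1/2)
    (l : Fin n → SubI (2*m)) (r : Fin n) :
    Lamι m n (tensorOp (fun s => if s < r then kinv i
          else if s = r then (Eop (-i)).comp (Kinv i) else Kinv i) (tT l))
      = (q ^ (∑ k ∈ (II (2*n)).filter (fun k => -((r : ℚ) + 1/2) ≤ k),
            ((Aι (fun s => (l s).1) p k : ℤ) - (Aι (fun s => (l s).1) p' k : ℤ)) + 1)
          * qint (Aι (fun s => (l s).1) p' (-((r : ℚ) + 1/2))))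
        • tP (Xiι m n n)
          (matMove (Aι fun s => (l s).1) p (-((r : ℚ) + 1/2)) p' (-((r : ℚ) + 1/2))) := by
  have hpp : p' ≠ p := by rw [hp, hp']; linarith
  have hnp : -i - 1/2 = -p := by rw [hp]; ring
  have hnp' : -i + 1/2 = -p' := by rw [hp']; ring
  rw [qint_Aι_neg_half_smul]
  split_ifs with h
  · rw [sum_II_filter_neg_half_le_add_one hpp h]
    refine Lamι_tensorOp_update r (-p) _ ?_ ?_ ?_
    · simp only [lt_irrefl, if_false, if_true, Eop, SOp.comp, Kinv, diagOp]
      rw [h, hp, hp']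
      ring
    · intro s hs
      simp only [hs, if_false]
      split_ifs <;> rfl
    · intro s
      rcases lt_trichotomy s r with hs | rfl | hs
      · simp only [hs, if_true, kinv, Kinv, Kpos, SOp.comp, diagOp, ← hp, ← hp', hnp, hnp']
        rw [← zpow_add₀ q_ne_zero]
        exact congrArg _ (add_comm _ _)
      · simp only [lt_irrefl, if_true, if_false, Kinv, Eop, SOp.comp, diagOp, ← hp, ← hp', hnp', h,
          mul_one, add_zero]
      · simp only [hs.not_gt, hs.ne', if_false, Kinv, diagOp, ← hp, ← hp', add_zero]
  · refine Lamι_tensorOp_eq_zero r ?_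
    simp only [lt_irrefl, if_false, if_true, Eop, SOp.comp, Kinv, diagOp, hnp']
    rw [if_neg h, mul_zero]

theorem Lamι_tensorOp_Eop_zero (l : Fin n → SubI (2*m)) (r : Fin n) :
    q⁻¹ • Lamι m n (tensorOp (fun s => if s < r then SOp.id'
          else if s = r then (Eop 0).comp (Kinv 0) else Kinv 0) (tT l))
      = (q ^ (∑ k ∈ (II (2*n)).filter (fun k => -((r : ℚ) + 1/2) ≤ k),
            ((Aι (fun s => (l s).1) (1/2) k : ℤ) - (Aι (fun s => (l s).1) (-(1/2)) k : ℤ)))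
          * qint (Aι (fun s => (l s).1) (-(1/2)) (-((r : ℚ) + 1/2))))
        • tP (Xiι m n n)
          (matMove (Aι fun s => (l s).1) (1/2) (-((r : ℚ) + 1/2)) (-(1/2)) (-((r : ℚ) + 1/2))) := by
  rw [qint_Aι_neg_half_smul, neg_neg]
  split_ifs with h
  · rw [inv_smul_eq_iff₀ q_ne_zero, smul_smul, ← zpow_one_add₀ q_ne_zero, add_comm (1 : ℤ),
      sum_II_filter_neg_half_le_self one_half_pos.ne' h]
    refine Lamι_tensorOp_update r (-(1/2)) _ ?_ ?_ ?_
    · simp only [lt_irrefl, if_false, if_true, Eop, SOp.comp, Kinv, diagOp]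
      rw [h]
      ring
    · intro s hs
      simp only [hs, if_false]
      split_ifs <;> rfl
    · intro s
      rcases lt_trichotomy s r with hs | rfl | hs
      · simp only [hs, if_true, SOp.id', zpow_zero]
      · simp only [lt_irrefl, if_true, if_false, Kinv, Eop, SOp.comp, diagOp, h, mul_one, zero_add,
          zero_sub]
      · simp only [hs.not_gt, hs.ne', if_false, Kinv, diagOp, zero_add, zero_sub]
  · rw [Lamι_tensorOp_eq_zero r, smul_zero]
    simp only [lt_irrefl, if_false, if_true, Eop, SOp.comp, Kinv, diagOp, zero_add]
    exact mul_eq_zero_of_right _ (if_neg h)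

theorem Lamι_tensorOp_diagOp (f : ℚ → ℤ) (l : Fin n → SubI (2*m)) :
    Lamι m n (tensorOp (fun _ => diagOp f) (tT l))
      = q ^ (∑ s, f (l s).1) • tP (Xiι m n n) (Aι fun s => (l s).1) := by
  rw [Lamι_tensorOp, ← prod_q_zpow]
  rfl

theorem tT_hom_ext {M : ℕ} {W : Type*} [AddCommMonoid W] [Module K W] {φ ψ : TV n M →ₗ[K] W}
    (h : ∀ l, φ (tT l) = ψ (tT l)) : φ = ψ :=
  Finsupp.lhom_ext' fun l => LinearMap.ext_ring (h l)

theorem Lamι_tT (l : Fin n → SubI (2*m)) :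
    Lamι m n (tT l) = tP (Xiι m n n) (Aι fun r => (l r).1) := by
  rw [tT, Lamι_single, one_smul]

theorem opOf_Lamι_tT (f : Mat → FM (Xiι m n n)) (l : Fin n → SubI (2*m)) :
    opOf f (Lamι m n (tT l)) = f (Aι fun r => (l r).1) := by
  rw [Lamι_tT, opOf_tP f (Aι_coe_mem_Xi0ι l).1]

theorem Lamι_comp_calB (i : ℚ) :
    Lamι m n ∘ₗ calB n (2*m) i = BLι n (Xiι m n n) i ∘ₗ Lamι m n := by
  refine tT_hom_ext fun l => ?_
  rw [LinearMap.comp_apply, LinearMap.comp_apply, BLι, opOf_Lamι_tT, sum_II_two_mul,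
    Finset.sum_add_distrib]
  simp only [calB, LinearMap.add_apply, LinearMap.sum_apply, map_add, map_sum]
  exact congrArg₂ _ (Finset.sum_congr rfl fun r _ => Lamι_tensorOp_Fop rfl rfl l r)
    (Finset.sum_congr rfl fun r _ => Lamι_tensorOp_Eop_neg rfl rfl l r)

theorem Lamι_comp_calB0 :
    Lamι m n ∘ₗ calB0 n (2*m) = BL0ι n (Xiι m n n) ∘ₗ Lamι m n := by
  refine tT_hom_ext fun l => ?_
  rw [LinearMap.comp_apply, LinearMap.comp_apply, BL0ι, opOf_Lamι_tT, sum_II_two_mul,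
    Finset.sum_add_distrib]
  simp only [calB0, LinearMap.add_apply, LinearMap.smul_apply, LinearMap.sum_apply, map_add,
    map_sum, map_smul, Finset.smul_sum]
  refine congrArg₂ _ (congrArg₂ _ (Finset.sum_congr rfl fun r _ => ?_)
    (Finset.sum_congr rfl fun r _ => ?_)) ?_
  · rw [if_pos (half_pos' r)]
    exact Lamι_tensorOp_Fop (zero_add _).symm (zero_sub _).symm l r
  · rw [if_neg (by linarith [half_pos' r] : ¬ 0 < -((r : ℚ) + 1/2)), add_zero]
    exact Lamι_tensorOp_Eop_zero l r
  · rw [sum_II_filter_pos, Kinv, Lamι_tensorOp_diagOp, zero_add, zero_sub]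

theorem Lamι_comp_calD (r : ℚ) :
    Lamι m n ∘ₗ calD n (2*m) r 1 = dLι n (Xiι m n n) r 1 ∘ₗ Lamι m n := by
  refine tT_hom_ext fun l => ?_
  rw [LinearMap.comp_apply, LinearMap.comp_apply, dLι, opOf_Lamι_tT, sum_II_two_mul, calD, DDop,
    Lamι_tensorOp_diagOp, one_mul]
  congr 2
  refine Finset.sum_congr rfl fun s _ => ?_
  rw [Aι_half, Aι_neg_half, one_mul]
  simp only [Nat.cast_ite, Nat.cast_one, Nat.cast_zero, @eq_comm ℚ r, neg_eq_iff_eq_neg]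

theorem Lamι_injective : Function.Injective (Lamι m n) := by
  let f : (Fin n → SubI (2*m)) → {A : Mat // A ∈ Xiι m n n} :=
    fun l => ⟨Aι fun r => (l r).1, (Aι_coe_mem_Xi0ι l).1⟩
  have hf : Function.Injective f := by
    intro l l' h
    funext r
    exact Subtype.ext (congrFun (Aι_injective (congrArg Subtype.val h)) r)
  have h : Lamι m n = Finsupp.lmapDomain K K f := by
    refine tT_hom_ext fun l => ?_
    rw [Lamι_tT, tT, Finsupp.lmapDomain_apply, Finsupp.mapDomain_single]
    exact dif_pos _
  rw [h]
  exact Finsupp.mapDomain_injective hf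

theorem range_Lamι : LinearMap.range (Lamι m n) = V0ι m n := by
  have h : Lamι m n
      = Finsupp.linearCombination K fun l => tP (Xiι m n n) (Aι fun r => (l r).1) := by
    refine tT_hom_ext fun l => ?_
    rw [Lamι_tT, tT, Finsupp.linearCombination_single, one_smul]
  rw [h, Finsupp.range_linearCombination, V0ι]
  congr 1
  ext v
  constructor
  · rintro ⟨l, rfl⟩
    exact ⟨_, Aι_coe_mem_Xi0ι l, rfl⟩
  · rintro ⟨A, hA, rfl⟩
    obtain ⟨l, rfl⟩ := exists_eq_Aι hA
    exact ⟨fun r => ⟨l r, (Aι_mem_Xi0ι_iff l).1 hA r⟩, rfl⟩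

theorem mapsTo_V0ι {S : TV n (2*m) →ₗ[K] TV n (2*m)}
    {T : FM (Xiι m n n) →ₗ[K] FM (Xiι m n n)} (h : Lamι m n ∘ₗ S = T ∘ₗ Lamι m n) :
    ∀ v ∈ V0ι m n, T v ∈ V0ι m n := by
  rw [← range_Lamι]
  rintro _ ⟨w, rfl⟩
  exact ⟨S w, LinearMap.congr_fun h w⟩

theorem Lamι_comp_ite (i : ℚ) :
    Lamι m n ∘ₗ (if i = 0 then calB0 n (2*m) else calB n (2*m) i)
      = (if i = 0 then BL0ι n (Xiι m n n) else BLι n (Xiι m n n) i) ∘ₗ Lamι m n := by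
  split_ifs
  · exact Lamι_comp_calB0
  · exact Lamι_comp_calB i

end Operators

theorem stmt0 (m n : ℕ) (hm : 1 ≤ m) (hn : 1 ≤ n) :
    -- (1) invariance of the ı-weight ρ̄ space under the left action
    (∀ i ∈ II (2*m - 1), ∀ v ∈ V0ι m n,
        (if i = 0 then BL0ι n (Xiι m n n) else BLι n (Xiι m n n) i) v ∈ V0ι m n) ∧
    (∀ r ∈ II (2*m), 0 < r → ∀ v ∈ V0ι m n, dLι n (Xiι m n n) r 1 v ∈ V0ι m n) ∧
    -- (2) Λ^ı is a bijection from V^{⊗n} onto 𝒱^{ı,0}_{m|n,n}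
    (Function.Injective ⇑(Lamι m n) ∧ Set.range ⇑(Lamι m n) = ↑(V0ι m n)) ∧
    -- (3) Λ^ı intertwines the two actions
    (∀ i ∈ II (2*m - 1), ∀ v : TV n (2*m),
        Lamι m n ((if i = 0 then calB0 n (2*m) else calB n (2*m) i) v)
          = (if i = 0 then BL0ι n (Xiι m n n) else BLι n (Xiι m n n) i) (Lamι m n v)) ∧
    (∀ r ∈ II (2*m), 0 < r → ∀ v : TV n (2*m),
        Lamι m n (calD n (2*m) r 1 v) = dLι n (Xiι m n n) r 1 (Lamι m n v)) := by
  exact ⟨fun i _ => mapsTo_V0ι (Lamι_comp_ite i), fun r _ _ => mapsTo_V0ι (Lamι_comp_calD r),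
    ⟨Lamι_injective, by rw [← LinearMap.coe_range, range_Lamι]⟩,
    fun i _ v => LinearMap.congr_fun (Lamι_comp_ite i) v,
    fun r _ _ v => LinearMap.congr_fun (Lamι_comp_calD r) v⟩

end
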